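/- arXiv:2510.14780 — 2 statements merged into one kernel-verified Lean document; each statement's English description precedes it below -/
import Mathlib

section
/- Lemma 3.8 (the recursive residual statistic eliminates the latent disturbances): Let V be a real vector space, let ε_1, …, ε_n and e_1, …, e_n be elements of V, and let α_{ih} ∈ ℝ for 1 ≤ h < i ≤ n. Define X_i = ε_i + Σ_{h<i} α_{ih} ε_h + e_i, and recursively ẽ_1 = X_1 and ẽ_i = X_i − Σ_{h<i} α_{ih} ẽ_h for i ≥ 2. Then: (1) for every i there exist real numbers c_{i1}, …, c_{ii} such that ẽ_i = ε_i + Σ_{h=1}^{i} c_{ih} e_h; and (2) for all s ≤ i, X_i − Σ_{h=1}^{s−1} α_{ih} ẽ_h = ε_i + Σ_{h=s}^{i−1} α_{ih} ε_h + e_i + u for some u lying in the linear span of {e_1, …, e_{s−1}}. -/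
open Finset

/-- Subtracting from `X i` the residuals of index below `s` removes the `ε h` with `h < s`, up to
the error term `-∑ h < s, α i h • (etil h - ε h)`. -/
lemma partial_residual_eq {ι V : Type*} [Fintype ι] [LinearOrder ι] [AddCommGroup V] [Module ℝ V]
    {ε e X : ι → V} {α : ι → ι → ℝ} (etil : ι → V)
    (hX : ∀ i, X i = ε i + (∑ h ∈ Finset.univ.filter (· < i), α i h • ε h) + e i)
    {s i : ι} (hsi : s ≤ i) :
    X i - (∑ h ∈ Finset.univ.filter (· < s), α i h • etil h)
      = ε i + (∑ h ∈ Finset.univ.filter (fun h => s ≤ h ∧ h < i), α i h • ε h) + e i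
        + -∑ h ∈ Finset.univ.filter (· < s), α i h • (etil h - ε h) := by
  have hsplit : ∑ h ∈ Finset.univ.filter (· < i), α i h • ε h
      = ∑ h ∈ Finset.univ.filter (· < s), α i h • ε h
        + ∑ h ∈ Finset.univ.filter (fun h => s ≤ h ∧ h < i), α i h • ε h := by
    rw [← Finset.sum_filter_add_sum_filter_not (Finset.univ.filter (· < i)) (· < s)]
    congr 2 <;> ext h <;> simp only [Finset.mem_filter, Finset.mem_univ, true_and, not_lt]
    · exact ⟨And.right, fun hs => ⟨hs.trans_le hsi, hs⟩⟩
    · exact and_comm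
  simp only [hX i, hsplit, smul_sub, Finset.sum_sub_distrib]
  abel

/-- If each `d h` lies in the span of the `e k` with `k ≤ h`, then every combination of the `d h`
with `h < s` lies in the span of the `e k` with `k < s`. -/
lemma sum_lt_smul_mem_span {ι V : Type*} [Fintype ι] [LinearOrder ι] [AddCommGroup V] [Module ℝ V]
    {e d : ι → V} {s : ι}
    (hd : ∀ h < s, d h ∈ Submodule.span ℝ (e '' {k | k ≤ h})) (a : ι → ℝ) :
    ∑ h ∈ Finset.univ.filter (· < s), a h • d h ∈ Submodule.span ℝ (e '' {k | k < s}) := by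
  refine Submodule.sum_mem _ fun h hh => Submodule.smul_mem _ _ ?_
  have hhs : h < s := by simpa using hh
  exact Submodule.span_mono (Set.image_mono fun k hk => lt_of_le_of_lt hk hhs) (hd h hhs)

/-- Each residual differs from its latent disturbance by an element of the span of the observed
disturbances of at most the same index. -/
lemma residual_sub_latent_mem_span {ι V : Type*} [Fintype ι] [LinearOrder ι] [AddCommGroup V]
    [Module ℝ V] {ε e X etil : ι → V} {α : ι → ι → ℝ}
    (hX : ∀ i, X i = ε i + (∑ h ∈ Finset.univ.filter (· < i), α i h • ε h) + e i)
    (hetil : ∀ i, etil i = X i - ∑ h ∈ Finset.univ.filter (· < i), α i h • etil h) (i : ι) :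
    etil i - ε i ∈ Submodule.span ℝ (e '' {k | k ≤ i}) := by
  induction i using WellFoundedLT.induction with
  | ind i ih =>
    have hempty : Finset.univ.filter (fun h => i ≤ h ∧ h < i) = ∅ :=
      Finset.filter_eq_empty_iff.2 fun h _ hh => hh.1.not_gt hh.2
    have heq : etil i - ε i
        = e i - ∑ h ∈ Finset.univ.filter (· < i), α i h • (etil h - ε h) := by
      rw [hetil i, partial_residual_eq etil hX le_rfl, hempty, Finset.sum_empty]
      abel
    rw [heq]
    refine Submodule.sub_mem _ (Submodule.subset_span ⟨i, le_rfl, rfl⟩) ?_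
    exact Submodule.span_mono (Set.image_mono fun k hk => le_of_lt hk)
      (sum_lt_smul_mem_span ih (α i))

/-- **Lemma 3.8 (the recursive residual statistic eliminates the latent disturbances)**:
in a real vector space, with `X i = ε i + ∑_{h<i} α i h • ε h + e i` and the recursive
residuals `ẽ i = X i − ∑_{h<i} α i h • ẽ h` (so `ẽ` for the least index equals `X`),
(1) each `ẽ i` equals `ε i` plus a linear combination of `e_1, …, e_i`, and
(2) for all `s ≤ i`, `X i − ∑_{h<s} α i h • ẽ h = ε i + ∑_{s≤h<i} α i h • ε h + e i + u`
for some `u` in the span of `{e h | h < s}`. -/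
theorem residual_statistic_eliminates_latents
    {V : Type*} [AddCommGroup V] [Module ℝ V]
    {n : ℕ} (ε e : Fin n → V) (α : Fin n → Fin n → ℝ)
    (X etil : Fin n → V)
    (hX : ∀ i, X i = ε i + (∑ h ∈ Finset.univ.filter (· < i), α i h • ε h) + e i)
    (hetil : ∀ i, etil i = X i - ∑ h ∈ Finset.univ.filter (· < i), α i h • etil h) :
    (∀ i, ∃ c : Fin n → ℝ,
        etil i = ε i + ∑ h ∈ Finset.univ.filter (· ≤ i), c h • e h) ∧
    (∀ s i : Fin n, s ≤ i →
        ∃ u ∈ Submodule.span ℝ (e '' {h | h < s}),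
          X i - (∑ h ∈ Finset.univ.filter (· < s), α i h • etil h)
            = ε i + (∑ h ∈ Finset.univ.filter (fun h => s ≤ h ∧ h < i), α i h • ε h)
                + e i + u) := by
  have hmem := residual_sub_latent_mem_span hX hetil
  refine ⟨fun i => ?_, fun s i hsi => ⟨_, ?_, partial_residual_eq etil hX hsi⟩⟩
  · have hi : etil i - ε i ∈
        Submodule.span ℝ (e '' (Finset.univ.filter (· ≤ i) : Finset (Fin n))) := by
      simpa using hmem i
    obtain ⟨c, hc⟩ := (Submodule.mem_span_image_finset_iff_exists_fun' ℝ).1 hi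
    exact ⟨c, by rw [hc, add_sub_cancel]⟩
  · exact Submodule.neg_mem _ (sum_lt_smul_mem_span (fun h _ => hmem h) (α i))
end

section
/- Decomposition of total effects through a fixed intermediate node (the engine of Lemma A.2): Let B be a strictly lower triangular real n×n matrix and let k < i < j be indices in {1,…,n}. Let B⁽ⁱ⁾ denote the matrix obtained from B by replacing its i-th row and its i-th column with zeros. Then I − B and I − B⁽ⁱ⁾ are invertible, and ((I − B)⁻¹)_{jk} = ((I − B)⁻¹)_{ji} · ((I − B)⁻¹)_{ik} + ((I − B⁽ⁱ⁾)⁻¹)_{jk}. -/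
open Matrix

namespace Matrix

variable {ι R : Type*} [Fintype ι] [LinearOrder ι] [CommRing R] {B : Matrix ι ι R}

theorem isUnit_one_sub_of_strictLower (hB : ∀ p q, p ≤ q → B p q = 0) : IsUnit (1 - B) := by
  have h : (1 - B).IsLowerTriangular := fun p q hpq => by
    have hlt : p < q := hpq
    simp [one_apply_ne hlt.ne, hB p q hlt.le]
  rw [isUnit_iff_isUnit_det, det_of_isLowerTriangular _ h]
  simp [hB _ _ le_rfl]

theorem inv_one_sub_apply_self_of_strictLower (hB : ∀ p q, p ≤ q → B p q = 0) (i : ι) :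
    (1 - B)⁻¹ i i = 1 := by
  have hU := isUnit_one_sub_of_strictLower hB
  have hT : BlockTriangular (1 - B) OrderDual.toDual := fun p q hpq => by
    have hlt : p < q := hpq
    simp [one_apply_ne hlt.ne, hB p q hlt.le]
  let := hU.invertible
  have hinv := blockTriangular_inv_of_blockTriangular hT
  have h := congrFun₂ (nonsing_inv_mul (1 - B) ((isUnit_iff_isUnit_det _).1 hU)) i i
  rw [mul_apply, Finset.sum_eq_single i] at h
  · simpa [hB i i le_rfl] using h
  · intro q _ hqi
    rcases lt_or_gt_of_ne hqi with hlt | hgt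
    · simp [one_apply_ne hqi, hB q i hlt.le]
    · rw [hinv (show OrderDual.toDual q < OrderDual.toDual i from hgt), zero_mul]
  · simp

/-- If `M` is a right inverse of `1 - B` with `M i i = 1`, then subtracting from `M` the paths
through `i` gives a right inverse of `1 - B` with the `i`-th row and column of `B` zeroed. -/
theorem one_sub_zeroed_mul_eq_one {M : Matrix ι ι R} {i : ι} (hM : (1 - B) * M = 1)
    (hii : M i i = 1) :
    (1 - of fun p q => if p = i ∨ q = i then 0 else B p q) *
      (M - vecMulVec (M.col i) (M.row i) + single i i 1) = 1 := by
  set X := M - vecMulVec (M.col i) (M.row i) + single i i 1 with hX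
  have hXi (q : ι) : X i q = (1 : Matrix ι ι R) i q := by
    simp [hX, vecMulVec_apply, hii, single_apply, one_apply]
  have hBX : (1 - B) * X = 1 - vecMulVec ((1 : Matrix ι ι R).col i) (M.row i)
      + (1 - B) * single i i 1 := by
    have hcol : (1 - B) *ᵥ M.col i = (1 : Matrix ι ι R).col i := by
      exact congrArg (fun N : Matrix ι ι R => N.col i) hM
    rw [hX, mul_add, mul_sub, hM, mul_vecMulVec, hcol]
  ext p q
  by_cases hp : p = i
  · subst hp
    rw [sub_mul, one_mul, sub_apply, hXi, mul_apply]
    simp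
  · have hpq := congrFun₂ hBX p q
    have hsum : ((of fun p q => if p = i ∨ q = i then 0 else B p q) * X) p q
        = (B * X) p q - B p i * X i q := by
      rw [mul_apply, mul_apply, ← Finset.sum_erase_eq_sub (Finset.mem_univ i)]
      rw [← Finset.sum_erase (a := i) Finset.univ (by simp)]
      exact Finset.sum_congr rfl fun r hr => by simp [hp, Finset.ne_of_mem_erase hr]
    have hsingle : (B * single i i (1 : R)) p q = B p i * (1 : Matrix ι ι R) i q := by
      by_cases hq : q = i
      · subst hq; simp
      · simp [one_apply_ne (Ne.symm hq), hq]
    have hs0 : (single i i 1 : Matrix ι ι R) p q = 0 := by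
      simp [Ne.symm hp]
    rw [sub_mul, one_mul, add_apply, sub_apply, sub_apply, sub_mul, one_mul, sub_apply,
      hsingle, hs0, vecMulVec_apply, col_apply, one_apply_ne hp] at hpq
    rw [sub_mul, one_mul, sub_apply, hsum, hXi]
    linear_combination hpq

end Matrix

/-- **Decomposition of total effects through a fixed intermediate node** (the engine of
Lemma A.2): for a strictly lower triangular real matrix `B` and indices `k < i < j`,
with `B⁽ⁱ⁾` obtained from `B` by zeroing the `i`-th row and column, the matrices
`I − B` and `I − B⁽ⁱ⁾` are invertible and the total effects satisfy
`((I−B)⁻¹)_{jk} = ((I−B)⁻¹)_{ji} ((I−B)⁻¹)_{ik} + ((I−B⁽ⁱ⁾)⁻¹)_{jk}`. -/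
theorem total_effects_decompose_through_node
    {n : ℕ} (B : Matrix (Fin n) (Fin n) ℝ)
    (hB : ∀ p q : Fin n, p ≤ q → B p q = 0)
    (k i j : Fin n) (hki : k < i) (hij : i < j)
    (Bi : Matrix (Fin n) (Fin n) ℝ)
    (hBi : Bi = Matrix.of fun p q => if p = i ∨ q = i then 0 else B p q) :
    IsUnit (1 - B) ∧ IsUnit (1 - Bi) ∧
      (1 - B)⁻¹ j k = (1 - B)⁻¹ j i * (1 - B)⁻¹ i k + (1 - Bi)⁻¹ j k := by
  subst hBi
  have hU := isUnit_one_sub_of_strictLower hB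
  refine ⟨hU, isUnit_one_sub_of_strictLower fun p q hpq => by simp [hB p q hpq], ?_⟩
  rw [inv_eq_right_inv (one_sub_zeroed_mul_eq_one
    (mul_nonsing_inv _ ((isUnit_iff_isUnit_det _).1 hU))
    (inv_one_sub_apply_self_of_strictLower hB i))]
  simp [vecMulVec_apply, hij.ne]
end
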